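/- For every dataset D = (u_1, …, u_n) with max_{i∈[n]} |u_i| ≤ ℓ_*, the greedy estimate with contribution bound ℓ_* satisfies D̂_{ℓ_*}(D) ≥ (1/2)·DC(D). -/

import Mathlib

/-- The one-person greedy step: `g(u, S) = S ∪ {min (u \ S)}` if `u \ S ≠ ∅`,
and `g(u, S) = S` otherwise. -/
def gstep {Ω : Type*} [LinearOrder Ω] (u S : Finset Ω) : Finset Ω :=
  if h : (u \ S).Nonempty then insert ((u \ S).min' h) S else S

/-- One greedy pass over the dataset `D = (u_1, …, u_n)`:
`S ↦ g(u_n, g(u_{n−1}, …, g(u_1, S)…))`. -/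
def greedyPass {Ω : Type*} [LinearOrder Ω] (D : List (Finset Ω)) (S : Finset Ω) :
    Finset Ω :=
  D.foldl (fun T u => gstep u T) S

/-- The greedy estimate `D̂_ℓ(D)`: the cardinality of the set obtained by applying
the greedy pass over `D` exactly `ℓ` times, starting from the empty set. -/
def greedyEst {Ω : Type*} [LinearOrder Ω] (D : List (Finset Ω)) (ℓ : ℕ) : ℕ :=
  ((greedyPass D)^[ℓ] ∅).card

/-- The set of distinct elements of a dataset `D = (u_1, …, u_n)`. -/
def dsUnion {Ω : Type*} [DecidableEq Ω] (D : List (Finset Ω)) : Finset Ω :=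
  D.foldr (· ∪ ·) ∅

/-- The distinct count `DC(D) = |⋃ᵢ uᵢ|`. -/
def DC {Ω : Type*} [DecidableEq Ω] (D : List (Finset Ω)) : ℕ :=
  (dsUnion D).card

/-- The bounded distinct count
`D_ℓ(D) = max { |⋃ᵢ vᵢ| : vᵢ ⊆ uᵢ and |vᵢ| ≤ ℓ for all i }`. -/
noncomputable def boundedDC {Ω : Type*} [DecidableEq Ω] (D : List (Finset Ω)) (ℓ : ℕ) : ℕ :=
  sSup { k : ℕ | ∃ v : List (Finset Ω),
    List.Forall₂ (fun a b => a ⊆ b ∧ a.card ≤ ℓ) v D ∧ k = DC v }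

theorem subset_gstep {Ω : Type*} [LinearOrder Ω] (u S : Finset Ω) : S ⊆ gstep u S := by
  unfold gstep
  split_ifs
  · exact Finset.subset_insert _ _
  · exact Finset.Subset.refl _

theorem card_sdiff_gstep_le {Ω : Type*} [LinearOrder Ω] (u S : Finset Ω) :
    (u \ gstep u S).card ≤ (u \ S).card - 1 := by
  unfold gstep
  split_ifs with h
  · rw [Finset.sdiff_insert, Finset.card_erase_of_mem (Finset.min'_mem _ h)]
  · simp [Finset.not_nonempty_iff_eq_empty.mp h]

theorem subset_greedyPass {Ω : Type*} [LinearOrder Ω] (D : List (Finset Ω)) (S : Finset Ω) :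
    S ⊆ greedyPass D S := by
  induction D generalizing S with
  | nil => exact Finset.Subset.refl _
  | cons u D ih => exact (subset_gstep u S).trans (ih (gstep u S))

theorem card_sdiff_greedyPass_le {Ω : Type*} [LinearOrder Ω] {D : List (Finset Ω)}
    {u : Finset Ω} (hu : u ∈ D) (S : Finset Ω) :
    (u \ greedyPass D S).card ≤ (u \ S).card - 1 := by
  induction D generalizing S with
  | nil => simp at hu
  | cons v D ih =>
    rcases List.mem_cons.mp hu with rfl | hu
    · exact (Finset.card_le_card (Finset.sdiff_subset_sdiff (Finset.Subset.refl u)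
        (subset_greedyPass D (gstep u S)))).trans (card_sdiff_gstep_le u S)
    · exact (ih hu (gstep v S)).trans (Nat.sub_le_sub_right (Finset.card_le_card
        (Finset.sdiff_subset_sdiff (Finset.Subset.refl u) (subset_gstep v S))) 1)

theorem card_sdiff_iterate_greedyPass_le {Ω : Type*} [LinearOrder Ω] {D : List (Finset Ω)}
    {u : Finset Ω} (hu : u ∈ D) (k : ℕ) :
    (u \ (greedyPass D)^[k] ∅).card ≤ u.card - k := by
  induction k with
  | zero => simp
  | succ k ih =>
    rw [Function.iterate_succ_apply']
    have := card_sdiff_greedyPass_le hu ((greedyPass D)^[k] ∅)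
    omega

theorem dsUnion_subset {Ω : Type*} [DecidableEq Ω] {D : List (Finset Ω)} {T : Finset Ω}
    (h : ∀ u ∈ D, u ⊆ T) : dsUnion D ⊆ T := by
  induction D with
  | nil => exact Finset.empty_subset T
  | cons u D ih =>
    exact Finset.union_subset (h u List.mem_cons_self)
      (ih fun v hv => h v (List.mem_cons_of_mem u hv))

/-- If every person contributes at most `ℓ₀` elements, then `ℓ₀` greedy passes collect every
element of the dataset. -/
theorem DC_le_greedyEst {Ω : Type*} [LinearOrder Ω] (D : List (Finset Ω)) (ℓ₀ : ℕ)
    (hbound : ∀ u ∈ D, u.card ≤ ℓ₀) : DC D ≤ greedyEst D ℓ₀ := by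
  refine Finset.card_le_card (dsUnion_subset fun u hu => ?_)
  rw [← Finset.sdiff_eq_empty_iff_subset, ← Finset.card_eq_zero]
  have := card_sdiff_iterate_greedyPass_le hu ℓ₀
  have := hbound u hu
  omega

/-- If every person contributes at most `ℓ₀` elements, then the greedy estimate with
contribution bound `ℓ₀` satisfies `D̂_{ℓ₀}(D) ≥ (1/2)·DC(D)`. -/
theorem greedyEst_half_DC {Ω : Type*} [LinearOrder Ω]
    (D : List (Finset Ω)) (ℓ₀ : ℕ) (hbound : ∀ u ∈ D, u.card ≤ ℓ₀) :
    (DC D : ℝ) / 2 ≤ (greedyEst D ℓ₀ : ℝ) := by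
  have h : (DC D : ℝ) ≤ greedyEst D ℓ₀ := by exact_mod_cast DC_le_greedyEst D ℓ₀ hbound
  have h₀ : (0 : ℝ) ≤ DC D := Nat.cast_nonneg _
  linarith
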